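/- Let Φ be a random power-law k-SAT formula with n variables, m clauses, k ≥ 3, and power-law exponent β > (2k−3)/(k−2). Let ε be a constant with 0 < ε < (k−1)(β−2)/(β−1) − 1, and set c = (k−1) − (1+ε)(β−1)/(β−2). If Δ = m/n ∈ o(n^ε/log^ε n), then there exists r ∈ Θ(n · Δ^{−1/ε}) such that the clause-variable incidence graph G(Φ) is an (r, c)-bipartite expander asymptotically almost surely. -/

import Mathlib

open Filter Finset

namespace PLSAT

/-- Weight of variable `i` (0-indexed): variable `i+1` has weight `(i+1)^{-1/(β-1)}`. -/
noncomputable def wt (β : ℝ) {n : ℕ} (i : Fin n) : ℝ :=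
  ((i : ℕ) + 1 : ℝ) ^ (-(1 : ℝ) / (β - 1))

noncomputable def totalWt (β : ℝ) (n : ℕ) : ℝ := ∑ i : Fin n, wt β i

/-- A sampled clause: an ordered tuple of `k` variables together with their signs. -/
abbrev Draw (n k : ℕ) := (Fin k → Fin n) × (Fin k → Bool)

/-- A sampled formula: `m` independently sampled clauses. -/
abbrev Formula (n m k : ℕ) := Fin m → Draw n k

/-- Probability mass of one sampled clause: the `k` distinct variables are drawn
without replacement with probabilities proportional to their weights, and each of
the `k` signs is chosen independently uniformly at random. -/
noncomputable def clauseMass (β : ℝ) {n : ℕ} (k : ℕ) (c : Draw n k) : ℝ :=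
  if Function.Injective c.1 then
    (1 / 2) ^ k *
      ∏ j : Fin k,
        wt β (c.1 j) /
          (totalWt β n - ∑ l ∈ Finset.univ.filter (fun l : Fin k => l < j), wt β (c.1 l))
  else 0

/-- Probability mass of a formula: clauses are sampled independently. -/
noncomputable def mass (β : ℝ) {n m k : ℕ} (φ : Formula n m k) : ℝ :=
  ∏ i : Fin m, clauseMass β k (φ i)

/-- Probability of an event in the power-law random `k`-SAT model. -/
noncomputable def Pr (β : ℝ) (n m k : ℕ) (E : Set (Formula n m k)) : ℝ :=
  ∑ φ : Formula n m k, E.indicator (mass β) φ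

def Satisfies {n k : ℕ} (a : Fin n → Bool) (c : Draw n k) : Prop :=
  ∃ j : Fin k, a (c.1 j) = c.2 j

def Unsat {n m k : ℕ} (φ : Formula n m k) : Prop :=
  ¬ ∃ a : Fin n → Bool, ∀ i : Fin m, Satisfies a (φ i)

/-- A resolution clause: a finite set of literals. -/
abbrev RClause (n : ℕ) := Finset (Fin n × Bool)

def toRClause {n k : ℕ} (c : Draw n k) : RClause n :=
  Finset.image (fun j => (c.1 j, c.2 j)) Finset.univ

def cnf {n m k : ℕ} (φ : Formula n m k) : Set (RClause n) :=
  Set.range fun i : Fin m => toRClause (φ i)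

/-- `C` is obtained by resolving `A` and `B` on some variable. -/
def IsResolvent {n : ℕ} (A B C : RClause n) : Prop :=
  ∃ x : Fin n, (x, true) ∈ A ∧ (x, false) ∈ B ∧
    C = A.erase (x, true) ∪ B.erase (x, false)

/-- `L` is a resolution refutation of the clause set `S`. -/
def IsRefutation {n : ℕ} (S : Set (RClause n)) (L : List (RClause n)) : Prop :=
  (∀ i : Fin L.length, L.get i ∈ S ∨
      ∃ j l : Fin L.length, (j : ℕ) < (i : ℕ) ∧ (l : ℕ) < (i : ℕ) ∧
        IsResolvent (L.get j) (L.get l) (L.get i)) ∧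
  (∅ : RClause n) ∈ L

def HasRefutationOfWidth {n : ℕ} (S : Set (RClause n)) (w : ℕ) : Prop :=
  ∃ L : List (RClause n), IsRefutation S L ∧ ∀ C ∈ L, C.card ≤ w

/-- The resolution width of `φ` is at least `b`: every resolution refutation
contains a clause of size at least `b`. -/
def widthAtLeast {n m k : ℕ} (b : ℝ) (φ : Formula n m k) : Prop :=
  ∀ w : ℕ, HasRefutationOfWidth (cnf φ) w → b ≤ (w : ℝ)

/-- Tree-like resolution derivations: `TreeDeriv S C s` holds if there is a tree-like
resolution derivation of clause `C` from the clause set `S` with `s` nodes. -/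
inductive TreeDeriv {n : ℕ} (S : Set (RClause n)) : RClause n → ℕ → Prop
  | ax : ∀ C ∈ S, TreeDeriv S C 1
  | res : ∀ (A B C : RClause n) (sa sb : ℕ), IsResolvent A B C →
      TreeDeriv S A sa → TreeDeriv S B sb → TreeDeriv S C (sa + sb + 1)

/-- The neighborhood of a set of clauses in the clause-variable incidence graph. -/
def nbhd {n m k : ℕ} (φ : Formula n m k) (Cs : Finset (Fin m)) : Finset (Fin n) :=
  Cs.biUnion fun i => Finset.image (φ i).1 Finset.univ

/-- `G(φ)` is an `(r, c)`-bipartite expander. -/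
def IsBipartiteExpander {n m k : ℕ} (φ : Formula n m k) (r : ℕ) (c : ℝ) : Prop :=
  ∀ Cs : Finset (Fin m), Cs.card ≤ r → (1 + c) * (Cs.card : ℝ) ≤ ((nbhd φ Cs).card : ℝ)

/-- The variables occurring in exactly one clause of `Cs`. -/
def uniqueVars {n m k : ℕ} (φ : Formula n m k) (Cs : Finset (Fin m)) : Finset (Fin n) :=
  (nbhd φ Cs).filter fun v =>
    (Cs.filter fun i => v ∈ Finset.image (φ i).1 Finset.univ).card = 1

end PLSAT

namespace PLSAT

variable {β : ℝ} {n m k : ℕ}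

lemma wt_pos (β : ℝ) (i : Fin n) : 0 < wt β i := by
  unfold wt; positivity

lemma wt_le_one (hβ : 1 < β) (i : Fin n) : wt β i ≤ 1 := by
  unfold wt
  apply Real.rpow_le_one_of_one_le_of_nonpos
  · have : (0 : ℝ) ≤ (i : ℕ) := Nat.cast_nonneg _
    linarith
  · exact div_nonpos_of_nonpos_of_nonneg (by norm_num) (by linarith)

/-! ### The clause masses form a probability distribution -/

lemma sum_snoc {α : Type*} [Fintype α] (k : ℕ) (g : (Fin (k + 1) → α) → ℝ) :
    ∑ f, g f = ∑ f : Fin k → α, ∑ v, g (Fin.snoc f v) := by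
  rw [← (Fin.snocEquiv fun _ : Fin (k + 1) => α).sum_comp, Fintype.sum_prod_type,
    Finset.sum_comm]
  rfl

/-- The total weight of the entries of `f` preceding position `j`. -/
lemma sum_lt_snoc (f : Fin k → Fin n) (v : Fin n) (j : Fin k) :
    ∑ l ∈ Finset.univ.filter (fun l : Fin (k + 1) => l < j.castSucc),
        wt β ((Fin.snoc f v : Fin (k + 1) → Fin n) l) =
      ∑ l ∈ Finset.univ.filter (fun l : Fin k => l < j), wt β (f l) := by
  rw [Finset.sum_filter, Finset.sum_filter, Fin.sum_univ_castSucc]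
  simp [Fin.not_lt.2 (Fin.le_last _)]

lemma sum_lt_last_snoc (f : Fin k → Fin n) (v : Fin n) :
    ∑ l ∈ Finset.univ.filter (fun l : Fin (k + 1) => l < Fin.last k),
        wt β ((Fin.snoc f v : Fin (k + 1) → Fin n) l) = ∑ l, wt β (f l) := by
  rw [Finset.sum_filter, Fin.sum_univ_castSucc]
  simp [Fin.castSucc_lt_last]

lemma sum_compl_range (f : Fin k → Fin n) (hf : Function.Injective f) :
    totalWt β n - ∑ l, wt β (f l) = ∑ v ∈ (Finset.univ.image f)ᶜ, wt β v := by
  rw [totalWt, ← Finset.sum_compl_add_sum (Finset.univ.image f),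
    Finset.sum_image fun _ _ _ _ h => hf h]
  ring

lemma sum_orderedMass (β : ℝ) (k : ℕ) (hk : k ≤ n) :
    ∑ f : Fin k → Fin n, (if Function.Injective f then
      ∏ j : Fin k, wt β (f j) /
        (totalWt β n - ∑ l ∈ Finset.univ.filter (fun l : Fin k => l < j), wt β (f l))
      else 0) = 1 := by
  induction k with
  | zero => simp [Function.injective_of_subsingleton]
  | succ k ih =>
    rw [sum_snoc, ← ih (by omega)]
    refine Finset.sum_congr rfl fun f _ => ?_
    by_cases hf : Function.Injective f
    · have hpos : 0 < ∑ v ∈ (Finset.univ.image f)ᶜ, wt β v := by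
        refine Finset.sum_pos (fun v _ => wt_pos β v) ?_
        rw [← Finset.card_pos, Finset.card_compl, Finset.card_image_of_injective _ hf]
        simp; omega
      simp only [Fin.snoc_injective_iff, hf, true_and, if_true, Fin.prod_univ_castSucc,
        sum_lt_snoc, sum_lt_last_snoc, Fin.snoc_castSucc, Fin.snoc_last]
      rw [← Finset.sum_filter, ← Finset.mul_sum, ← Finset.sum_div, sum_compl_range f hf]
      have : Finset.univ.filter (fun v => v ∉ Set.range f) = (Finset.univ.image f)ᶜ := by
        ext; simp
      rw [this, div_self hpos.ne', mul_one]
    · simp [Fin.snoc_injective_iff, hf]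

lemma sum_clauseMass_mul (β : ℝ) (k : ℕ) (h : (Fin k → Fin n) → ℝ) :
    ∑ d : Draw n k, clauseMass β k d * h d.1 =
      ∑ f : Fin k → Fin n, (if Function.Injective f then
        ∏ j : Fin k, wt β (f j) /
          (totalWt β n - ∑ l ∈ Finset.univ.filter (fun l : Fin k => l < j), wt β (f l))
        else 0) * h f := by
  rw [Fintype.sum_prod_type]
  refine Finset.sum_congr rfl fun f _ => ?_
  simp only [clauseMass, Finset.sum_const, Finset.card_univ, Fintype.card_pi, Fintype.card_bool,
    Finset.prod_const, Fintype.card_fin, nsmul_eq_mul]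
  split_ifs
  · rw [← mul_assoc, ← mul_assoc]
    push_cast
    rw [← mul_pow]
    norm_num
  · simp

lemma sum_clauseMass (β : ℝ) (hk : k ≤ n) : ∑ d : Draw n k, clauseMass β k d = 1 := by
  have := sum_clauseMass_mul (n := n) β k fun _ => 1
  simp only [mul_one] at this
  rw [this, sum_orderedMass β k hk]

lemma denominator_nonneg (f : Fin k → Fin n) (hf : Function.Injective f) (j : Fin k) :
    0 ≤ totalWt β n - ∑ l ∈ Finset.univ.filter (fun l : Fin k => l < j), wt β (f l) := by
  rw [sub_nonneg, ← Finset.sum_image (f := wt β) fun _ _ _ _ h => hf h]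
  exact Finset.sum_le_sum_of_subset_of_nonneg (Finset.subset_univ _) fun v _ _ => (wt_pos β v).le

lemma clauseMass_nonneg (β : ℝ) (d : Draw n k) : 0 ≤ clauseMass β k d := by
  unfold clauseMass
  split_ifs with h
  · exact mul_nonneg (by positivity) (Finset.prod_nonneg fun j _ =>
      div_nonneg (wt_pos β _).le (denominator_nonneg _ h j))
  · exact le_rfl

lemma mass_nonneg (β : ℝ) (φ : Formula n m k) : 0 ≤ mass β φ :=
  Finset.prod_nonneg fun _ _ => clauseMass_nonneg β _

lemma sum_mass (β : ℝ) (m : ℕ) (hk : k ≤ n) : ∑ φ : Formula n m k, mass β φ = 1 := by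
  unfold mass
  rw [← Fintype.sum_pow, sum_clauseMass β hk, one_pow]

/-- Resampling one clause does not change expectations. -/
lemma sum_mass_mul_resample (hk : k ≤ n) (i : Fin m) (g : Formula n m k → ℝ) :
    ∑ φ, mass β φ * g φ =
      ∑ φ : Formula n m k, mass β φ * ∑ d, clauseMass β k d * g (Function.update φ i d) := by
  have swap : ∑ x : Formula n m k × Draw n k, mass β x.1 * (clauseMass β k x.2 * g x.1) =
      ∑ x : Formula n m k × Draw n k,
        mass β x.1 * (clauseMass β k x.2 * g (Function.update x.1 i x.2)) := by
    refine Finset.sum_nbij' (fun x => (Function.update x.1 i x.2, x.1 i))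
      (fun x => (Function.update x.1 i x.2, x.1 i)) (by simp) (by simp) (by simp) (by simp) ?_
    rintro ⟨φ, d⟩ -
    simp only [Function.update_idem, Function.update_eq_self, mass]
    have hrest : ∏ j ∈ Finset.univ.erase i, clauseMass β k (Function.update φ i d j) =
        ∏ j ∈ Finset.univ.erase i, clauseMass β k (φ j) :=
      Finset.prod_congr rfl fun j hj => by
        rw [Function.update_of_ne (Finset.ne_of_mem_erase hj)]
    rw [← Finset.mul_prod_erase _ _ (Finset.mem_univ i),
      ← Finset.mul_prod_erase (a := i) (f := fun j => clauseMass β k (Function.update φ i d j)) _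
        (Finset.mem_univ i), hrest]
    simp only [Function.update_self]
    ring
  rw [Fintype.sum_prod_type, Fintype.sum_prod_type] at swap
  simp only [← Finset.mul_sum] at swap
  rw [← swap]
  simp only [← Finset.sum_mul, sum_clauseMass β hk, one_mul]

/-! ### A moment bound for the size of neighborhoods -/

/-- Moment bound for the support of `k` independent draws from a measure `q` of mass at most `2`. -/
lemma sum_prod_mul_pow_card_le {q : Fin n → ℝ} (hq : ∀ v, 0 ≤ q v) (hq2 : ∑ v, q v ≤ 2)
    {p : ℝ} (hp0 : 0 ≤ p) {M : ℕ} (hM : ∀ B : Finset (Fin n), B.card ≤ M → ∑ v ∈ B, q v ≤ p)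
    (k : ℕ) (A : Finset (Fin n)) (hA : A.card + k ≤ M) :
    ∑ f : Fin k → Fin n, (∏ j, q (f j)) * p ^ (A ∪ Finset.univ.image f).card ≤
      (3 * p) ^ k * p ^ A.card := by
  induction k with
  | zero => simp
  | succ k ih =>
    have hstep : ∀ f : Fin k → Fin n,
        ∑ v, q v * p ^ (insert v (A ∪ Finset.univ.image f)).card ≤
          3 * p * p ^ (A ∪ Finset.univ.image f).card := by
      intro f
      set B := A ∪ Finset.univ.image f with hB
      have hcard : B.card ≤ M := by
        have h1 := Finset.card_union_le A (Finset.univ.image f)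
        have h2 : (Finset.univ.image f).card ≤ k := by
          simpa using Finset.card_image_le (s := Finset.univ) (f := f)
        rw [hB]
        omega
      have hpB : 0 ≤ p ^ B.card := by positivity
      calc ∑ v, q v * p ^ (insert v B).card
          ≤ ∑ v, ((if v ∈ B then q v else 0) * p ^ B.card + q v * (p * p ^ B.card)) := by
            refine Finset.sum_le_sum fun v _ => ?_
            by_cases hv : v ∈ B
            · rw [Finset.insert_eq_of_mem hv, if_pos hv]
              have := mul_nonneg (hq v) (mul_nonneg hp0 hpB)
              linarith
            · rw [Finset.card_insert_of_notMem hv, if_neg hv, pow_succ']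
              simp
        _ = (∑ v ∈ B, q v) * p ^ B.card + (∑ v, q v) * (p * p ^ B.card) := by
            rw [Finset.sum_add_distrib, ← Finset.sum_mul, ← Finset.sum_mul]
            simp
        _ ≤ p * p ^ B.card + 2 * (p * p ^ B.card) := by
            gcongr
            exact hM B hcard
        _ = _ := by ring
    have himg : ∀ (f : Fin k → Fin n) (v : Fin n),
        A ∪ Finset.univ.image (Fin.snoc f v : Fin (k + 1) → Fin n) =
          insert v (A ∪ Finset.univ.image f) := by
      intro f v
      ext x
      simp only [Finset.mem_union, Finset.mem_image, Finset.mem_univ, true_and, Fin.exists_fin_succ',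
        Fin.snoc_castSucc, Fin.snoc_last, Finset.mem_insert]
      tauto
    calc _ = ∑ f : Fin k → Fin n, (∏ j, q (f j)) *
          ∑ v, q v * p ^ (insert v (A ∪ Finset.univ.image f)).card := by
            rw [sum_snoc]
            simp only [Fin.prod_univ_castSucc, Fin.snoc_castSucc, Fin.snoc_last, himg,
              Finset.mul_sum, mul_assoc]
      _ ≤ ∑ f : Fin k → Fin n, (∏ j, q (f j)) *
          (3 * p * p ^ (A ∪ Finset.univ.image f).card) := by
            refine Finset.sum_le_sum fun f _ => mul_le_mul_of_nonneg_left (hstep f) ?_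
            exact Finset.prod_nonneg fun _ _ => hq _
      _ = 3 * p * ∑ f : Fin k → Fin n, (∏ j, q (f j)) *
          p ^ (A ∪ Finset.univ.image f).card := by
            rw [Finset.mul_sum]
            exact Finset.sum_congr rfl fun _ _ => by ring
      _ ≤ 3 * p * ((3 * p) ^ k * p ^ A.card) := by
            gcongr
            exact ih (by omega)
      _ = _ := by ring

lemma sum_wt_comp_le (hβ : 1 < β) (s : Finset (Fin k)) (f : Fin k → Fin n) :
    ∑ l ∈ s, wt β (f l) ≤ k := by
  calc ∑ l ∈ s, wt β (f l) ≤ ∑ l ∈ s, (1 : ℝ) := Finset.sum_le_sum fun l _ => wt_le_one hβ _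
    _ ≤ k := by simpa using Finset.card_le_univ s

lemma sum_clauseMass_mul_le (hβ : 1 < β) (hk : 0 < k) (hW : 2 * (k : ℝ) ≤ totalWt β n)
    (h : (Fin k → Fin n) → ℝ) (hh : ∀ f, 0 ≤ h f) :
    ∑ d : Draw n k, clauseMass β k d * h d.1 ≤
      ∑ f : Fin k → Fin n, (∏ j, 2 * wt β (f j) / totalWt β n) * h f := by
  rw [sum_clauseMass_mul]
  have hk' : (0 : ℝ) < k := Nat.cast_pos.2 hk
  have hW0 : 0 < totalWt β n := by linarith
  refine Finset.sum_le_sum fun f _ => mul_le_mul_of_nonneg_right ?_ (hh f)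
  split_ifs with hf
  · refine Finset.prod_le_prod (fun j _ => div_nonneg (wt_pos β _).le
      (denominator_nonneg _ hf j)) fun j _ => ?_
    have h1 := sum_wt_comp_le hβ (Finset.univ.filter (fun l : Fin k => l < j)) f
    have h2 := wt_pos β (f j)
    rw [div_le_div_iff₀ (by linarith) hW0]
    nlinarith
  · exact Finset.prod_nonneg fun j _ => div_nonneg (mul_nonneg zero_le_two (wt_pos β _).le) hW0.le

lemma card_nbhd_le (φ : Formula n m k) (Cs : Finset (Fin m)) :
    (nbhd φ Cs).card ≤ Cs.card * k := by
  refine Finset.card_biUnion_le_card_mul _ _ _ fun i _ => ?_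
  simpa using Finset.card_image_le (s := Finset.univ) (f := (φ i).1)

lemma nbhd_insert_update (φ : Formula n m k) {i : Fin m} {Cs : Finset (Fin m)} (hi : i ∉ Cs)
    (d : Draw n k) :
    nbhd (Function.update φ i d) (insert i Cs) = nbhd φ Cs ∪ Finset.univ.image d.1 := by
  unfold nbhd
  rw [Finset.biUnion_insert, Function.update_self, Finset.union_comm]
  congr 1
  refine Finset.biUnion_congr rfl fun j hj => ?_
  rw [Function.update_of_ne (ne_of_mem_of_not_mem hj hi)]

lemma sum_mass_mul_pow_card_nbhd_le (hβ : 1 < β) (hk : 0 < k) (hkn : k ≤ n)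
    (hW : 2 * (k : ℝ) ≤ totalWt β n) {p : ℝ} (hp0 : 0 ≤ p) {M : ℕ}
    (hM : ∀ B : Finset (Fin n), B.card ≤ M → ∑ v ∈ B, 2 * wt β v / totalWt β n ≤ p)
    (Cs : Finset (Fin m)) (hCs : Cs.card * k ≤ M) :
    ∑ φ : Formula n m k, mass β φ * p ^ (nbhd φ Cs).card ≤ (3 * p) ^ (k * Cs.card) := by
  have hk' : (0 : ℝ) < k := Nat.cast_pos.2 hk
  have hW0 : 0 < totalWt β n := by linarith
  induction Cs using Finset.induction_on with
  | empty => simp [nbhd, sum_mass β m hkn]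
  | insert i Cs hi ih =>
    rw [Finset.card_insert_of_notMem hi] at hCs ⊢
    have hCs' : Cs.card * k + k ≤ M := by rw [← Nat.succ_mul]; exact hCs
    rw [sum_mass_mul_resample hkn i]
    simp only [nbhd_insert_update _ hi]
    calc _ ≤ ∑ φ : Formula n m k, mass β φ * ((3 * p) ^ k * p ^ (nbhd φ Cs).card) := by
            refine Finset.sum_le_sum fun φ _ => mul_le_mul_of_nonneg_left ?_ (mass_nonneg β φ)
            refine (sum_clauseMass_mul_le hβ hk hW
              (fun f => p ^ (nbhd φ Cs ∪ Finset.univ.image f).card) fun f => by positivity).trans ?_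
            refine sum_prod_mul_pow_card_le (q := fun v => 2 * wt β v / totalWt β n)
              (fun v => div_nonneg (mul_nonneg zero_le_two (wt_pos β _).le) hW0.le) ?_ hp0 hM k _ ?_
            · rw [← Finset.sum_div, ← Finset.mul_sum, ← totalWt, mul_div_assoc,
                div_self hW0.ne', mul_one]
            · have := card_nbhd_le φ Cs
              omega
      _ = (3 * p) ^ k * ∑ φ : Formula n m k, mass β φ * p ^ (nbhd φ Cs).card := by
            rw [Finset.mul_sum]
            exact Finset.sum_congr rfl fun _ _ => by ring
      _ ≤ (3 * p) ^ k * (3 * p) ^ (k * Cs.card) := by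
            gcongr
            exact ih (by omega)
      _ = _ := by rw [← pow_add]; ring_nf

/-! ### Power-law weight estimates -/

lemma sum_range_rpow_le {γ : ℝ} (hγ0 : 0 < γ) (hγ1 : γ ≤ 1) (b : ℕ) :
    ∑ i ∈ Finset.range b, ((i : ℝ) + 1) ^ (γ - 1) ≤ (b : ℝ) ^ γ / γ := by
  induction b with
  | zero => simp [Real.zero_rpow hγ0.ne']
  | succ b ih =>
    rw [Finset.sum_range_succ]
    have hb : (0 : ℝ) < (b : ℝ) + 1 := by positivity
    have bern := rpow_one_add_le_one_add_mul_self (s := -1 / ((b : ℝ) + 1))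
      (by rw [le_div_iff₀ hb]; linarith [Nat.cast_nonneg (α := ℝ) b]) hγ0.le hγ1
    have hfrac : 1 + -1 / ((b : ℝ) + 1) = b / (b + 1) := by field_simp; ring
    rw [hfrac, Real.div_rpow (Nat.cast_nonneg b) hb.le,
      div_le_iff₀ (Real.rpow_pos_of_pos hb γ)] at bern
    have hpow : ((b : ℝ) + 1) ^ (γ - 1) = ((b : ℝ) + 1) ^ γ / (b + 1) := by
      rw [Real.rpow_sub_one hb.ne']
    have key : (b : ℝ) ^ γ + γ * ((b : ℝ) + 1) ^ (γ - 1) ≤ ((b : ℝ) + 1) ^ γ := by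
      rw [hpow]
      calc _ ≤ (1 + γ * (-1 / ((b : ℝ) + 1))) * ((b : ℝ) + 1) ^ γ +
            γ * (((b : ℝ) + 1) ^ γ / (b + 1)) := by gcongr
        _ = _ := by ring
    push_cast
    rw [le_div_iff₀ hγ0] at ih ⊢
    linarith

lemma wt_eq (hβ : 1 < β) {γ : ℝ} (hγ : γ = (β - 2) / (β - 1)) (i : Fin n) :
    wt β i = ((i : ℕ) + 1 : ℝ) ^ (γ - 1) := by
  have : β - 1 ≠ 0 := by linarith
  rw [wt, hγ]
  congr 1
  field_simp
  ring

lemma sum_wt_le (hβ : 2 < β) {γ : ℝ} (hγ : γ = (β - 2) / (β - 1)) (B : Finset (Fin n)) :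
    ∑ v ∈ B, wt β v ≤ (1 / γ + 1) * (B.card : ℝ) ^ γ := by
  have hγ0 : 0 < γ := by rw [hγ]; exact div_pos (by linarith) (by linarith)
  have hγ1 : γ ≤ 1 := by rw [hγ, div_le_one (by linarith)]; linarith
  rcases B.eq_empty_or_nonempty with rfl | hB
  · simp [Real.zero_rpow hγ0.ne']
  set b := B.card with hb
  have hb0 : (0 : ℝ) < b := by exact_mod_cast hB.card_pos
  rw [← Finset.sum_filter_add_sum_filter_not B (fun v : Fin n => (v : ℕ) < b)]
  have hlow : ∑ v ∈ B.filter (fun v : Fin n => (v : ℕ) < b), wt β v ≤ (b : ℝ) ^ γ / γ := by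
    refine le_trans ?_ (sum_range_rpow_le hγ0 hγ1 b)
    rw [Finset.sum_congr rfl fun v _ => wt_eq (by linarith) hγ v,
      ← Finset.sum_image (f := fun i : ℕ => ((i : ℝ) + 1) ^ (γ - 1)) (g := Fin.val)
        (Fin.val_injective.injOn)]
    refine Finset.sum_le_sum_of_subset_of_nonneg ?_ fun i _ _ => by positivity
    intro i hi
    simp only [Finset.mem_image, Finset.mem_filter] at hi
    obtain ⟨v, hv, rfl⟩ := hi
    exact Finset.mem_range.2 hv.2
  have hhigh : ∑ v ∈ B.filter (fun v : Fin n => ¬ (v : ℕ) < b), wt β v ≤ (b : ℝ) ^ γ := by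
    calc _ ≤ ∑ v ∈ B.filter (fun v : Fin n => ¬ (v : ℕ) < b), (b : ℝ) ^ (γ - 1) := by
            refine Finset.sum_le_sum fun v hv => ?_
            rw [wt_eq (by linarith) hγ]
            refine Real.rpow_le_rpow_of_nonpos hb0 ?_ (by linarith)
            have : b ≤ (v : ℕ) := not_lt.1 (Finset.mem_filter.1 hv).2
            have : (b : ℝ) ≤ (v : ℕ) := by exact_mod_cast this
            linarith
      _ ≤ b * (b : ℝ) ^ (γ - 1) := by
            rw [Finset.sum_const, nsmul_eq_mul]
            gcongr
            exact Finset.card_filter_le B _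
      _ = (b : ℝ) ^ γ := by
            rw [Real.rpow_sub_one hb0.ne']
            field_simp
  calc _ ≤ (b : ℝ) ^ γ / γ + (b : ℝ) ^ γ := add_le_add hlow hhigh
    _ = _ := by ring

lemma rpow_le_totalWt (hβ : 2 < β) {γ : ℝ} (hγ : γ = (β - 2) / (β - 1)) (hn : 0 < n) :
    (n : ℝ) ^ γ ≤ totalWt β n := by
  have hγ1 : γ ≤ 1 := by rw [hγ, div_le_one (by linarith)]; linarith
  have hn' : (0 : ℝ) < n := Nat.cast_pos.2 hn
  calc (n : ℝ) ^ γ = ∑ _v : Fin n, (n : ℝ) ^ (γ - 1) := by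
        rw [Finset.sum_const, nsmul_eq_mul, Finset.card_univ, Fintype.card_fin,
          Real.rpow_sub_one hn'.ne']
        field_simp
    _ ≤ _ := by
        refine Finset.sum_le_sum fun v _ => ?_
        rw [wt_eq (by linarith) hγ]
        refine Real.rpow_le_rpow_of_nonpos (by positivity) ?_ (by linarith)
        exact_mod_cast v.2

/-! ### The union bound -/

lemma sum_mass_not_expanding_le (hβ : 1 < β) (hk : 0 < k) (hkn : k ≤ n)
    (hW : 2 * (k : ℝ) ≤ totalWt β n) {p c : ℝ} (hp0 : 0 < p) (hc : c ≤ (k : ℝ) - 1)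
    (Cs : Finset (Fin m))
    (hM : ∀ B : Finset (Fin n), B.card ≤ Cs.card * k →
      ∑ v ∈ B, 2 * wt β v / totalWt β n ≤ p) :
    ∑ φ : Formula n m k,
        (if ((nbhd φ Cs).card : ℝ) < (1 + c) * Cs.card then mass β φ else 0) ≤
      (3 ^ k * p ^ ((k : ℝ) - 1 - c)) ^ Cs.card := by
  rcases le_or_gt p 1 with hp1 | hp1
  · calc _ ≤ ∑ φ : Formula n m k,
          mass β φ * p ^ (nbhd φ Cs).card * p ^ (-((1 + c) * (Cs.card : ℝ))) := by
            refine Finset.sum_le_sum fun φ _ => ?_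
            have hm := mass_nonneg β φ
            split_ifs with h
            · rw [mul_assoc, ← Real.rpow_natCast p, ← Real.rpow_add hp0]
              refine le_mul_of_one_le_right hm ?_
              exact Real.one_le_rpow_of_pos_of_le_one_of_nonpos hp0 hp1 (by linarith)
            · positivity
      _ ≤ (3 * p) ^ (k * Cs.card) * p ^ (-((1 + c) * (Cs.card : ℝ))) := by
            rw [← Finset.sum_mul]
            gcongr
            exact sum_mass_mul_pow_card_nbhd_le hβ hk hkn hW hp0.le hM Cs le_rfl
      _ = _ := by
            rw [mul_pow, mul_pow, ← pow_mul, mul_assoc, ← Real.rpow_natCast p,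
              ← Real.rpow_add hp0, ← Real.rpow_natCast (p ^ _), ← Real.rpow_mul hp0.le]
            congr 2
            push_cast
            ring
  · calc _ ≤ ∑ φ : Formula n m k, mass β φ := by
            refine Finset.sum_le_sum fun φ _ => ?_
            have hm := mass_nonneg β φ
            split_ifs <;> simp [hm]
      _ = 1 := sum_mass β m hkn
      _ ≤ _ := by
            apply one_le_pow₀
            apply one_le_mul_of_one_le_of_one_le
            · exact one_le_pow₀ (by norm_num)
            · exact Real.one_le_rpow hp1.le (by linarith)

lemma choose_le_exp_pow (m s : ℕ) (hs : 0 < s) :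
    (m.choose s : ℝ) ≤ (Real.exp 1 * m / s) ^ s := by
  have hs' : (0 : ℝ) < s := Nat.cast_pos.2 hs
  have hfac : (0 : ℝ) < s.factorial := Nat.cast_pos.2 s.factorial_pos
  have hexp := Real.pow_div_factorial_le_exp (s : ℝ) hs'.le s
  calc (m.choose s : ℝ) ≤ (m : ℝ) ^ s / s.factorial := Nat.choose_le_pow_div s m
    _ = (m : ℝ) ^ s / (s : ℝ) ^ s * ((s : ℝ) ^ s / s.factorial) := by field_simp
    _ ≤ (m : ℝ) ^ s / (s : ℝ) ^ s * Real.exp s := by gcongr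
    _ = _ := by
        rw [div_pow, mul_pow, ← Real.exp_nat_mul, mul_one]
        ring

lemma Pr_le_one (hkn : k ≤ n) (E : Set (Formula n m k)) : Pr β n m k E ≤ 1 := by
  rw [Pr, ← sum_mass (k := k) β m hkn]
  exact Finset.sum_le_sum fun φ _ => Set.indicator_le_self' (fun _ _ => mass_nonneg β _) φ

lemma one_sub_Pr_expander_le (hkn : k ≤ n) (r : ℕ) (c : ℝ) :
    1 - Pr β n m k {φ | IsBipartiteExpander φ r c} ≤
      ∑ s ∈ Finset.Icc 1 r, ∑ Cs ∈ Finset.powersetCard s (Finset.univ : Finset (Fin m)),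
        ∑ φ : Formula n m k,
          (if ((nbhd φ Cs).card : ℝ) < (1 + c) * Cs.card then mass β φ else 0) := by
  have htotal : 1 - Pr β n m k {φ | IsBipartiteExpander φ r c} =
      ∑ φ : Formula n m k,
        (mass β φ - Set.indicator {φ | IsBipartiteExpander φ r c} (mass β) φ) := by
    rw [Finset.sum_sub_distrib, sum_mass β m hkn, Pr]
  rw [htotal]
  simp_rw [Finset.sum_comm (t := (Finset.univ : Finset (Formula n m k)))]
  refine Finset.sum_le_sum fun φ _ => ?_
  have hm := mass_nonneg β φ
  have hterm : ∀ Cs : Finset (Fin m),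
      0 ≤ (if ((nbhd φ Cs).card : ℝ) < (1 + c) * Cs.card then mass β φ else 0) := by
    intro Cs
    split_ifs <;> simp [hm]
  by_cases hφ : IsBipartiteExpander φ r c
  · rw [Set.indicator_of_mem (by exact hφ), sub_self]
    exact Finset.sum_nonneg fun s _ => Finset.sum_nonneg fun Cs _ => hterm Cs
  · rw [Set.indicator_of_notMem (by exact hφ), sub_zero]
    simp only [IsBipartiteExpander, not_forall, not_le] at hφ
    obtain ⟨Cs, hr, hlt⟩ := hφ
    have hpos : 1 ≤ Cs.card := by
      rw [Nat.one_le_iff_ne_zero]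
      intro h0
      rw [Finset.card_eq_zero] at h0
      subst h0
      simp [nbhd] at hlt
    calc mass β φ = (if ((nbhd φ Cs).card : ℝ) < (1 + c) * Cs.card then mass β φ else 0) := by
            rw [if_pos hlt]
      _ ≤ ∑ Ds ∈ Finset.powersetCard Cs.card (Finset.univ : Finset (Fin m)),
            (if ((nbhd φ Ds).card : ℝ) < (1 + c) * Ds.card then mass β φ else 0) :=
          Finset.single_le_sum (f := fun Ds : Finset (Fin m) =>
            if ((nbhd φ Ds).card : ℝ) < (1 + c) * Ds.card then mass β φ else 0)
            (fun Ds _ => hterm Ds) (by simp)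
      _ ≤ _ := Finset.single_le_sum (f := fun s =>
            ∑ Ds ∈ Finset.powersetCard s (Finset.univ : Finset (Fin m)),
              if ((nbhd φ Ds).card : ℝ) < (1 + c) * Ds.card then mass β φ else 0)
            (fun s _ => Finset.sum_nonneg fun Ds _ => hterm Ds)
            (Finset.mem_Icc.2 ⟨hpos, hr⟩)

/-- Quantitative form of the expansion property. -/
lemma exists_one_sub_Pr_expander_le (hk : 0 < k) (hβ : 2 < β) {ε c : ℝ} (hε : 0 < ε)
    (hc : c = ((k : ℝ) - 1) - (1 + ε) * (β - 1) / (β - 2)) :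
    ∃ L : ℝ, 0 < L ∧ ∀ᶠ n : ℕ in atTop, k ≤ n ∧ ∀ m r : ℕ,
      1 - Pr β n m k {φ | IsBipartiteExpander φ r c} ≤
        ∑ s ∈ Finset.Icc 1 r, (L * ((m : ℝ) / n) * ((s : ℝ) / n) ^ ε) ^ s := by
  obtain ⟨γ, hγ⟩ : ∃ γ, γ = (β - 2) / (β - 1) := ⟨_, rfl⟩
  have hγ0 : 0 < γ := by rw [hγ]; exact div_pos (by linarith) (by linarith)
  have hD : (k : ℝ) - 1 - c = (1 + ε) / γ := by
    have h1 : β - 1 ≠ 0 := by linarith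
    have h2 : β - 2 ≠ 0 := by linarith
    rw [hc, hγ]
    field_simp
    ring
  have hk' : (0 : ℝ) < k := Nat.cast_pos.2 hk
  set K : ℝ := 2 * (1 / γ + 1) * (k : ℝ) ^ γ with hK
  have hK0 : 0 < K := by positivity
  refine ⟨Real.exp 1 * 3 ^ k * K ^ ((1 + ε) / γ), by positivity, ?_⟩
  have hlarge : ∀ᶠ n : ℕ in atTop, 2 * (k : ℝ) ≤ (n : ℝ) ^ γ :=
    ((tendsto_rpow_atTop hγ0).comp tendsto_natCast_atTop_atTop).eventually_ge_atTop _
  filter_upwards [hlarge, eventually_ge_atTop k] with n hn hkn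
  refine ⟨hkn, fun m r => (one_sub_Pr_expander_le hkn r c).trans ?_⟩
  have hn0 : 0 < n := by omega
  have hn' : (0 : ℝ) < n := Nat.cast_pos.2 hn0
  have hWn := rpow_le_totalWt hβ hγ hn0
  have hnγ : 0 < (n : ℝ) ^ γ := Real.rpow_pos_of_pos hn' γ
  refine Finset.sum_le_sum fun s hs => ?_
  have hs0 : 0 < s := (Finset.mem_Icc.1 hs).1
  have hs' : (0 : ℝ) < s := Nat.cast_pos.2 hs0
  set p : ℝ := K * ((s : ℝ) / n) ^ γ with hp
  have hp0 : 0 < p := by positivity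
  have hpD : p ^ ((k : ℝ) - 1 - c) = K ^ ((1 + ε) / γ) * (((s : ℝ) / n) ^ ε * (s / n)) := by
    rw [hD, hp, Real.mul_rpow hK0.le (by positivity), ← Real.rpow_mul (by positivity),
      ← Real.rpow_add_one (by positivity)]
    congr 2
    field_simp
    ring
  have hM : ∀ B : Finset (Fin n), B.card ≤ s * k →
      ∑ v ∈ B, 2 * wt β v / totalWt β n ≤ p := by
    intro B hB
    have hB' : (B.card : ℝ) ≤ s * k := by exact_mod_cast hB
    rw [← Finset.sum_div, ← Finset.mul_sum]
    calc 2 * (∑ v ∈ B, wt β v) / totalWt β n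
        ≤ 2 * ((1 / γ + 1) * ((s : ℝ) * k) ^ γ) / (n : ℝ) ^ γ := by
          gcongr
          refine (sum_wt_le hβ hγ B).trans ?_
          gcongr
      _ = p := by
          rw [hp, hK, Real.mul_rpow hs'.le hk'.le, Real.div_rpow hs'.le hn'.le]
          ring
  calc _ ≤ ∑ Cs ∈ Finset.powersetCard s (Finset.univ : Finset (Fin m)),
          (3 ^ k * p ^ ((k : ℝ) - 1 - c)) ^ s := by
        refine Finset.sum_le_sum fun Cs hCs => ?_
        have hcard : Cs.card = s := (Finset.mem_powersetCard.1 hCs).2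
        have hck : c ≤ (k : ℝ) - 1 := by
          have : 0 < (1 + ε) / γ := by positivity
          linarith
        rw [← hcard] at hM
        have := sum_mass_not_expanding_le (m := m) (by linarith) hk hkn (hn.trans hWn) hp0 hck
          Cs hM
        rwa [hcard] at this ⊢
    _ = (m.choose s : ℝ) * (3 ^ k * p ^ ((k : ℝ) - 1 - c)) ^ s := by
        rw [Finset.sum_const, Finset.card_powersetCard, Finset.card_univ, Fintype.card_fin,
          nsmul_eq_mul]
    _ ≤ (Real.exp 1 * m / s) ^ s * (3 ^ k * p ^ ((k : ℝ) - 1 - c)) ^ s := by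
        gcongr
        exact choose_le_exp_pow m s hs0
    _ = _ := by
        rw [← mul_pow, hpD]
        congr 1
        field_simp

end PLSAT

open PLSAT in
/-- **Bipartite expansion of power-law random k-SAT (Lemma 5.6).**
For a random power-law `k`-SAT formula with `k ≥ 3`, `β > (2k-3)/(k-2)`, a constant
`0 < ε < (k-1)(β-2)/(β-1) - 1`, `c = (k-1) - (1+ε)(β-1)/(β-2)`, and
`Δ = m/n ∈ o(n^ε / log^ε n)`, there exists `r ∈ Θ(n · Δ^{-1/ε})` such that the
clause-variable incidence graph `G(Φ)` is an `(r, c)`-bipartite expander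
asymptotically almost surely. -/
theorem power_law_bipartite_expansion
    (k : ℕ) (hk : 3 ≤ k) (β : ℝ)
    (hβ : (2 * (k : ℝ) - 3) / ((k : ℝ) - 2) < β)
    (m : ℕ → ℕ)
    (Δ : ℕ → ℝ) (hΔ : ∀ n : ℕ, Δ n = (m n : ℝ) / (n : ℝ))
    (ε : ℝ) (hε : 0 < ε)
    (hεub : ε < ((k : ℝ) - 1) * (β - 2) / (β - 1) - 1)
    (c : ℝ) (hc : c = ((k : ℝ) - 1) - (1 + ε) * (β - 1) / (β - 2))
    (hΔo : Δ =o[atTop] fun n : ℕ => (n : ℝ) ^ ε / Real.log n ^ ε) :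
    ∃ r : ℕ → ℕ,
      (∃ c₁ > (0 : ℝ), ∃ c₂ > (0 : ℝ), ∀ᶠ n : ℕ in atTop,
        c₁ * ((n : ℝ) * Δ n ^ (-1 / ε)) ≤ (r n : ℝ) ∧
        (r n : ℝ) ≤ c₂ * ((n : ℝ) * Δ n ^ (-1 / ε))) ∧
      Tendsto (fun n : ℕ => Pr β n (m n) k
          {φ | IsBipartiteExpander φ (r n) c})
        atTop (nhds 1) := by
  have hβ2 : 2 < β := by
    have hk' : (3 : ℝ) ≤ k := by exact_mod_cast hk
    refine lt_trans ?_ hβ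
    rw [lt_div_iff₀ (by linarith)]
    linarith
  obtain ⟨L, hL, hPr⟩ := exists_one_sub_Pr_expander_le (by omega) hβ2 hε hc
  have hΔ0 : ∀ n, 0 ≤ Δ n := fun n => by rw [hΔ]; positivity
  set δ : ℝ := (1 / (2 * L)) ^ (1 / ε) with hδ
  have hδ0 : 0 < δ := by positivity
  have hδε : δ ^ ε = 1 / (2 * L) := by
    rw [hδ, ← Real.rpow_mul (by positivity), one_div_mul_cancel hε.ne', Real.rpow_one]
  have hne : -1 / ε ≠ 0 := div_ne_zero (by norm_num) hε.ne'
  have hΔε : ∀ n, 0 < Δ n → (Δ n ^ (-1 / ε)) ^ ε = (Δ n)⁻¹ := fun n h => by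
    rw [← Real.rpow_mul h.le, div_mul_cancel₀ _ hε.ne', Real.rpow_neg_one]
  have hΔlittle : Δ =o[atTop] fun n : ℕ => (n : ℝ) ^ ε := by
    refine hΔo.trans_isBigO (Asymptotics.IsBigO.of_bound 1 ?_)
    have hlog : ∀ᶠ n : ℕ in atTop, 1 ≤ Real.log n :=
      (Real.tendsto_log_atTop.comp tendsto_natCast_atTop_atTop).eventually_ge_atTop 1
    filter_upwards [hlog] with n hn
    have h1 : 1 ≤ Real.log n ^ ε := Real.one_le_rpow hn hε.le
    rw [one_mul, norm_div]
    refine div_le_self (norm_nonneg _) ?_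
    rwa [Real.norm_of_nonneg (by linarith)]
  refine ⟨fun n => ⌊δ * ((n : ℝ) * Δ n ^ (-1 / ε))⌋₊, ⟨δ / 2, by positivity, δ, hδ0, ?_⟩, ?_⟩
  · have hsmall := hΔlittle.def (c := δ ^ ε) (by positivity)
    filter_upwards [hsmall, eventually_gt_atTop 0] with n hn hn0
    have hn' : (0 : ℝ) < n := Nat.cast_pos.2 hn0
    have hX : 0 ≤ δ * ((n : ℝ) * Δ n ^ (-1 / ε)) :=
      mul_nonneg hδ0.le (mul_nonneg hn'.le (Real.rpow_nonneg (hΔ0 n) _))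
    refine ⟨?_, Nat.floor_le hX⟩
    rcases (hΔ0 n).eq_or_lt with h0 | hpos
    · simp [← h0, Real.zero_rpow hne]
    · have hone : 1 ≤ δ * ((n : ℝ) * Δ n ^ (-1 / ε)) := by
        rw [← Real.rpow_le_rpow_iff zero_le_one hX hε, Real.one_rpow,
          Real.mul_rpow hδ0.le (by positivity), Real.mul_rpow hn'.le (by positivity),
          hΔε n hpos, ← mul_assoc, ← div_eq_mul_inv, one_le_div hpos]
        rwa [Real.norm_of_nonneg hpos.le, Real.norm_of_nonneg (by positivity)] at hn
      have h1 : (1 : ℝ) ≤ ⌊δ * ((n : ℝ) * Δ n ^ (-1 / ε))⌋₊ := by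
        exact_mod_cast Nat.one_le_floor_iff _ |>.2 hone
      have h2 := Nat.lt_floor_add_one (δ * ((n : ℝ) * Δ n ^ (-1 / ε)))
      linarith
  · set r : ℕ → ℕ := fun n => ⌊δ * ((n : ℝ) * Δ n ^ (-1 / ε))⌋₊ with hr
    set f : ℕ → ℕ → ℝ := fun n s =>
      if s ∈ Finset.Icc 1 (r n) then (L * Δ n * ((s : ℝ) / n) ^ ε) ^ s else 0 with hf
    have hbase : ∀ n s : ℕ, 0 ≤ L * Δ n * ((s : ℝ) / n) ^ ε := fun n s =>
      mul_nonneg (mul_nonneg hL.le (hΔ0 n)) (by positivity)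
    have hf0 : ∀ n s, 0 ≤ f n s := fun n s => by
      simp only [hf]
      split_ifs
      · exact pow_nonneg (hbase n s) s
      · exact le_rfl
    have hdom : ∀ n, 0 < n → ∀ s, f n s ≤ (1 / 2 : ℝ) ^ s := by
      intro n hn0 s
      have hn' : (0 : ℝ) < n := Nat.cast_pos.2 hn0
      simp only [hf]
      split_ifs with hs
      · obtain ⟨hs1, hsr⟩ := Finset.mem_Icc.1 hs
        refine pow_le_pow_left₀ (hbase n s) ?_ s
        rcases (hΔ0 n).eq_or_lt with h0 | hpos
        · simp [← h0]
        · have hsX : (s : ℝ) ≤ δ * ((n : ℝ) * Δ n ^ (-1 / ε)) :=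
            (Nat.le_floor_iff (by positivity)).1 hsr
          have hsn : (s : ℝ) / n ≤ δ * Δ n ^ (-1 / ε) := by
            rw [div_le_iff₀ hn']
            linarith
          calc L * Δ n * ((s : ℝ) / n) ^ ε
              ≤ L * Δ n * (δ * Δ n ^ (-1 / ε)) ^ ε := by gcongr
            _ = 1 / 2 := by
                rw [Real.mul_rpow hδ0.le (by positivity), hΔε n hpos, hδε]
                field_simp
      · positivity
    have hpoint : ∀ s, Tendsto (fun n => f n s) atTop (nhds 0) := by
      intro s
      rcases Nat.eq_zero_or_pos s with rfl | hs
      · simp [hf]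
      · have hlim : Tendsto (fun n : ℕ => (L * (s : ℝ) ^ ε * (Δ n / (n : ℝ) ^ ε)) ^ s) atTop
            (nhds 0) := by
          have := (hΔlittle.tendsto_div_nhds_zero.const_mul (L * (s : ℝ) ^ ε)).pow s
          rwa [mul_zero, zero_pow hs.ne'] at this
        refine squeeze_zero (fun n => hf0 n s) (fun n => ?_) hlim
        have heq : L * Δ n * ((s : ℝ) / n) ^ ε = L * (s : ℝ) ^ ε * (Δ n / (n : ℝ) ^ ε) := by
          rw [Real.div_rpow (Nat.cast_nonneg _) (Nat.cast_nonneg _)]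
          ring
        have hnn := pow_nonneg (hbase n s) s
        rw [← heq]
        simp only [hf]
        split_ifs
        · exact le_rfl
        · exact hnn
    have htsum : Tendsto (fun n => ∑' s, f n s) atTop (nhds 0) := by
      have := tendsto_tsum_of_dominated_convergence (𝓕 := atTop) (f := f) (g := fun _ => (0 : ℝ))
        (bound := fun s => (1 / 2 : ℝ) ^ s) summable_geometric_two hpoint (by
          filter_upwards [eventually_gt_atTop 0] with n hn s
          rw [Real.norm_of_nonneg (hf0 n s)]
          exact hdom n hn s)
      simpa using this
    have hlower : Tendsto (fun n => 1 - ∑' s, f n s) atTop (nhds 1) := by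
      simpa using htsum.const_sub 1
    refine tendsto_of_tendsto_of_tendsto_of_le_of_le' hlower tendsto_const_nhds ?_ ?_
    · filter_upwards [hPr] with n hn
      have h1 := hn.2 (m n) (r n)
      have h2 : ∑' s, f n s = ∑ s ∈ Finset.Icc 1 (r n), (L * Δ n * ((s : ℝ) / n) ^ ε) ^ s := by
        rw [tsum_eq_sum (s := Finset.Icc 1 (r n)) fun s hs => if_neg hs]
        exact Finset.sum_congr rfl fun s hs => if_pos hs
      rw [← hΔ n, ← h2] at h1
      linarith
    · filter_upwards [hPr] with n hn
      exact Pr_le_one hn.1 _
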